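/- There is a constant C > 0 such that for all smooth divergence-free vector fields u, v, w : 𝕋² → ℝ², one has |b(u,v,w)| ≤ C ‖u‖_{H^{1,0}} ‖v‖_{H^{1,1}} ‖w‖_{L²}. -/

import Mathlib

open MeasureTheory Real Complex Filter Set

noncomputable section

namespace Aniso

/-- Fundamental domain `(0, 2π]` for the circle of circumference `2π`. -/
def I2pi : Set ℝ := Set.Ioc 0 (2 * π)

/-- Fundamental domain for the 2-torus `𝕋² = (ℝ/2πℤ)²`. -/
def Q2 : Set (ℝ × ℝ) := I2pi ×ˢ I2pi

/-- Integral over the torus of a real function. -/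
def tintR (f : ℝ × ℝ → ℝ) : ℝ := ∫ x in Q2, f x

/-- Smoothness of a scalar field. -/
def Smooth (f : ℝ × ℝ → ℝ) : Prop := ContDiff ℝ (⊤ : ℕ∞) f

/-- Smoothness of a vector field. -/
def SmoothV (u : ℝ × ℝ → ℝ × ℝ) : Prop := ContDiff ℝ (⊤ : ℕ∞) u

/-- `2π`-periodicity in each variable: this encodes being a function on the torus. -/
def Per (f : ℝ × ℝ → ℝ) : Prop :=
  (∀ x : ℝ × ℝ, f (x.1 + 2 * π, x.2) = f x) ∧ (∀ x : ℝ × ℝ, f (x.1, x.2 + 2 * π) = f x)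

def PerV (u : ℝ × ℝ → ℝ × ℝ) : Prop :=
  Per (fun x => (u x).1) ∧ Per (fun x => (u x).2)

/-- Partial derivative in the horizontal variable `x₁`. -/
def pd1 (f : ℝ × ℝ → ℝ) : ℝ × ℝ → ℝ := fun x => fderiv ℝ f x (1, 0)

/-- Partial derivative in the vertical variable `x₂`. -/
def pd2 (f : ℝ × ℝ → ℝ) : ℝ × ℝ → ℝ := fun x => fderiv ℝ f x (0, 1)

def comp1 (u : ℝ × ℝ → ℝ × ℝ) : ℝ × ℝ → ℝ := fun x => (u x).1
def comp2 (u : ℝ × ℝ → ℝ × ℝ) : ℝ × ℝ → ℝ := fun x => (u x).2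

def pd1V (u : ℝ × ℝ → ℝ × ℝ) : ℝ × ℝ → ℝ × ℝ := fun x => (pd1 (comp1 u) x, pd1 (comp2 u) x)
def pd2V (u : ℝ × ℝ → ℝ × ℝ) : ℝ × ℝ → ℝ × ℝ := fun x => (pd2 (comp1 u) x, pd2 (comp2 u) x)

/-- Divergence-free condition `∂₁u¹ + ∂₂u² = 0`. -/
def DivFree (u : ℝ × ℝ → ℝ × ℝ) : Prop :=
  ∀ x, pd1 (comp1 u) x + pd2 (comp2 u) x = 0

/-- The transport term `u·∇v`, with components `u¹∂₁vʲ + u²∂₂vʲ`. -/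
def advect (u v : ℝ × ℝ → ℝ × ℝ) : ℝ × ℝ → ℝ × ℝ := fun x =>
  ((u x).1 * pd1 (comp1 v) x + (u x).2 * pd2 (comp1 v) x,
   (u x).1 * pd1 (comp2 v) x + (u x).2 * pd2 (comp2 v) x)

/-- L² inner product of real vector fields on the torus (summed over components). -/
def ipV (u v : ℝ × ℝ → ℝ × ℝ) : ℝ := tintR fun x => (u x).1 * (v x).1 + (u x).2 * (v x).2

/-- The trilinear form `b(u,v,w) = ∫ (u·∇v)·w`. -/
def b3 (u v w : ℝ × ℝ → ℝ × ℝ) : ℝ := ipV (advect u v) w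

/-- L² norm of a scalar function on the torus. -/
def L2 (f : ℝ × ℝ → ℝ) : ℝ := Real.sqrt (tintR fun x => f x ^ 2)

/-- L² norm of a vector field on the torus. -/
def L2V (u : ℝ × ℝ → ℝ × ℝ) : ℝ := Real.sqrt (tintR fun x => (u x).1 ^ 2 + (u x).2 ^ 2)

/-- Fourier coefficient of a complex-valued function on the torus. -/
def fcC (f : ℝ × ℝ → ℂ) (k : ℤ × ℤ) : ℂ :=
  (1 / (2 * π) ^ 2 : ℂ) *
    ∫ x in Q2, f x * Complex.exp (-(Complex.I) * ((k.1 : ℂ) * (x.1 : ℂ) + (k.2 : ℂ) * (x.2 : ℂ)))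

/-- Fourier coefficient of a real-valued function on the torus. -/
def fc (f : ℝ × ℝ → ℝ) (k : ℤ × ℤ) : ℂ := fcC (fun x => (f x : ℂ)) k

/-- Anisotropic Sobolev weight `(1+|k₁|²)^s (1+|k₂|²)^{s'}`. -/
def aw (s s' : ℝ) (k : ℤ × ℤ) : ℝ :=
  (1 + (k.1 : ℝ) ^ 2) ^ s * (1 + (k.2 : ℝ) ^ 2) ^ s'

/-- Square of the anisotropic Sobolev norm `H^{s,s'}` of a scalar function. -/
def HSq (s s' : ℝ) (f : ℝ × ℝ → ℝ) : ℝ := ∑' k : ℤ × ℤ, aw s s' k * ‖fc f k‖ ^ 2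

/-- Anisotropic Sobolev norm `H^{s,s'}` of a scalar function. -/
def HN (s s' : ℝ) (f : ℝ × ℝ → ℝ) : ℝ := Real.sqrt (HSq s s' f)

/-- Anisotropic Sobolev norm `H^{s,s'}` of a vector field. -/
def HNV (s s' : ℝ) (u : ℝ × ℝ → ℝ × ℝ) : ℝ :=
  Real.sqrt (HSq s s' (comp1 u) + HSq s s' (comp2 u))

/-- Mixed norm `L^∞_h(L²_v)`. -/
def LinfhL2v (f : ℝ × ℝ → ℝ) : ℝ :=
  essSup (fun x1 : ℝ => Real.sqrt (∫ x2 in I2pi, f (x1, x2) ^ 2)) (volume.restrict I2pi)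

/-- Mixed norm `L²_h(L^∞_v)`. -/
def L2hLinfv (f : ℝ × ℝ → ℝ) : ℝ :=
  Real.sqrt (∫ x1 in I2pi, (essSup (fun x2 : ℝ => |f (x1, x2)|) (volume.restrict I2pi)) ^ 2)

/-- Mixed norm `L²_v(L^{4/3}_h)`. -/
def L2vL43h {E : Type*} [NormedAddCommGroup E] (f : ℝ × ℝ → E) : ℝ :=
  Real.sqrt (∫ x2 in I2pi, (∫ x1 in I2pi, ‖f (x1, x2)‖ ^ ((4 : ℝ)/3)) ^ ((3 : ℝ)/2))

/-- Mixed norm `L^∞_v(L²_h)`. -/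
def LinfvL2h {E : Type*} [NormedAddCommGroup E] (f : ℝ × ℝ → E) : ℝ :=
  essSup (fun x2 : ℝ => Real.sqrt (∫ x1 in I2pi, ‖f (x1, x2)‖ ^ 2)) (volume.restrict I2pi)

/-- Mixed norm `L²_v(L⁴_h)`. -/
def L2vL4h {E : Type*} [NormedAddCommGroup E] (f : ℝ × ℝ → E) : ℝ :=
  Real.sqrt (∫ x2 in I2pi, Real.sqrt (∫ x1 in I2pi, ‖f (x1, x2)‖ ^ 4))

/-- One-dimensional Fourier coefficient on the circle of circumference `2π`. -/
def fc1 (g : ℝ → ℂ) (n : ℤ) : ℂ :=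
  (1 / (2 * π) : ℂ) * ∫ x in I2pi, g x * Complex.exp (-(Complex.I) * ((n : ℂ) * (x : ℂ)))

/-- Square of the 1-d Sobolev norm `H^s(𝕋)`. -/
def H1Sq (s : ℝ) (g : ℝ → ℂ) : ℝ := ∑' n : ℤ, (1 + (n : ℝ) ^ 2) ^ s * ‖fc1 g n‖ ^ 2

/-- Mixed norm `L²_v(H^s_h)`. -/
def L2vHsh (s : ℝ) (f : ℝ × ℝ → ℂ) : ℝ :=
  Real.sqrt (∫ x2 in I2pi, H1Sq s (fun x1 => f (x1, x2)))

/-- A dyadic partition of unity `(χ, θ)` on `ℝ`. -/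
structure IsDyadicPartition (χ θ : ℝ → ℝ) : Prop where
  smooth_chi : ContDiff ℝ (⊤ : ℕ∞) χ
  smooth_theta : ContDiff ℝ (⊤ : ℕ∞) θ
  nonneg_chi : ∀ z, 0 ≤ χ z
  nonneg_theta : ∀ z, 0 ≤ θ z
  even_chi : ∀ z, χ (-z) = χ z
  even_theta : ∀ z, θ (-z) = θ z
  chi_support : ∃ R > 0, ∀ z, R ≤ |z| → χ z = 0
  theta_support : ∃ r R : ℝ, 0 < r ∧ r < R ∧ ∀ z, (|z| < r ∨ R < |z|) → θ z = 0
  partition : ∀ z : ℝ, χ z + ∑' j : ℕ, θ ((2 : ℝ) ^ (-(j : ℤ)) * z) = 1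
  chi_theta_disj : ∀ j : ℕ, 1 ≤ j → ∀ z, χ z * θ ((2 : ℝ) ^ (-(j : ℤ)) * z) = 0
  theta_theta_disj : ∀ i j : ℕ, 1 < |(i : ℤ) - (j : ℤ)| → ∀ z,
    θ ((2 : ℝ) ^ (-(i : ℤ)) * z) * θ ((2 : ℝ) ^ (-(j : ℤ)) * z) = 0

/-- The Fourier multiplier symbol of the vertical Littlewood–Paley block `Δ^v_j`. -/
def blockSymb (χ θ : ℝ → ℝ) (j : ℤ) (z : ℝ) : ℝ :=
  if j = -1 then χ |z| else if 0 ≤ j then θ ((2 : ℝ) ^ (-j) * |z|) else 0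

/-- The Fourier multiplier symbol of the vertical low-frequency cut-off `S^v_j`. -/
def lowSymb (χ θ : ℝ → ℝ) (j : ℤ) (z : ℝ) : ℝ :=
  ∑ j' ∈ Finset.Icc (-1 : ℤ) (j - 2), blockSymb χ θ j' z

/-- The character `e^{ik·x}`. -/
def eK (k : ℤ × ℤ) (x : ℝ × ℝ) : ℂ :=
  Complex.exp (Complex.I * ((k.1 : ℂ) * (x.1 : ℂ) + (k.2 : ℂ) * (x.2 : ℂ)))

/-- Vertical Littlewood–Paley block `Δ^v_j` of a complex-valued function. -/
def LPC (χ θ : ℝ → ℝ) (j : ℤ) (f : ℝ × ℝ → ℂ) : ℝ × ℝ → ℂ :=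
  fun x => ∑' k : ℤ × ℤ, (blockSymb χ θ j k.2 : ℂ) * fcC f k * eK k x

/-- Vertical Littlewood–Paley block `Δ^v_j` of a real-valued function. -/
def LP (χ θ : ℝ → ℝ) (j : ℤ) (f : ℝ × ℝ → ℝ) : ℝ × ℝ → ℂ :=
  LPC χ θ j fun x => (f x : ℂ)

/-- Vertical low-frequency cut-off `S^v_j` of a complex-valued function. -/
def SvC (χ θ : ℝ → ℝ) (j : ℤ) (f : ℝ × ℝ → ℂ) : ℝ × ℝ → ℂ :=
  fun x => ∑' k : ℤ × ℤ, (lowSymb χ θ j k.2 : ℂ) * fcC f k * eK k x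

/-- Vertical low-frequency cut-off `S^v_j` of a real-valued function. -/
def Sv (χ θ : ℝ → ℝ) (j : ℤ) (f : ℝ × ℝ → ℝ) : ℝ × ℝ → ℂ :=
  SvC χ θ j fun x => (f x : ℂ)

/-- Componentwise Littlewood–Paley block of a vector field. -/
def LPV (χ θ : ℝ → ℝ) (j : ℤ) (u : ℝ × ℝ → ℝ × ℝ) : ℝ × ℝ → ℂ × ℂ :=
  fun x => (LP χ θ j (comp1 u) x, LP χ θ j (comp2 u) x)

/-- Componentwise low-frequency cut-off of a vector field. -/
def SvV (χ θ : ℝ → ℝ) (j : ℤ) (u : ℝ × ℝ → ℝ × ℝ) : ℝ × ℝ → ℂ × ℂ :=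
  fun x => (Sv χ θ j (comp1 u) x, Sv χ θ j (comp2 u) x)

/-- L² inner product of complex-valued functions on the torus. -/
def ipC (f g : ℝ × ℝ → ℂ) : ℂ := ∫ x in Q2, f x * (starRingEnd ℂ) (g x)

/-- L² inner product of complex vector fields on the torus (summed over components). -/
def ipCV (f g : ℝ × ℝ → ℂ × ℂ) : ℂ :=
  ∫ x in Q2, ((f x).1 * (starRingEnd ℂ) ((g x).1) + (f x).2 * (starRingEnd ℂ) ((g x).2))

/-- The vertical paraproduct `T^v_a g = Σ_j S^v_{j-1}a · Δ^v_j g`. -/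
def Tv (χ θ : ℝ → ℝ) (a g : ℝ × ℝ → ℝ) : ℝ × ℝ → ℂ :=
  fun x => ∑' j : ℤ, Sv χ θ (j - 1) a x * LP χ θ j g x

/-- The vertical remainder `R^v(a,g) = Σ_{|j-j'|≤1} Δ^v_j a · Δ^v_{j'} g`. -/
def Rv (χ θ : ℝ → ℝ) (a g : ℝ × ℝ → ℝ) : ℝ × ℝ → ℂ :=
  fun x => ∑' p : ℤ × ℤ, if |p.1 - p.2| ≤ 1 then LP χ θ p.1 a x * LP χ θ p.2 g x else 0


section Parseval

open scoped Pointwise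

attribute [local instance] instMeasureSpaceUnitAddCircle

theorem isProbabilityMeasure_volume_unitAddCircle :
    IsProbabilityMeasure (volume : Measure UnitAddCircle) :=
  inferInstanceAs (IsProbabilityMeasure AddCircle.haarAddCircle)

/-- Rescaling integrals over the unit square to integrals over `Q2`. -/
theorem integral_unit_square_comp_smul {E : Type*} [NormedAddCommGroup E] [NormedSpace ℝ E]
    (G : ℝ × ℝ → E) :
    ∫ x in {x : Fin 2 → ℝ | ∀ i, x i ∈ Ioc (0 : ℝ) (0 + 1)}, G (2 * π * x 0, 2 * π * x 1) =
      ((2 * π) ^ 2)⁻¹ • ∫ z in Q2, G z := by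
  have hpi : (0 : ℝ) < 2 * π := by positivity
  have h1 := (volume_preserving_finTwoArrow ℝ).setIntegral_preimage_emb
    (MeasurableEquiv.measurableEmbedding _) (fun y => G ((2 * π) • y))
    (Ioc (0 : ℝ) 1 ×ˢ Ioc (0 : ℝ) 1)
  have h2 := Measure.setIntegral_comp_smul_of_pos (volume : Measure (ℝ × ℝ)) G
    (Ioc (0 : ℝ) 1 ×ˢ Ioc (0 : ℝ) 1) hpi
  have hs : (2 * π) • (Ioc (0 : ℝ) 1 ×ˢ Ioc (0 : ℝ) 1) = Q2 := by
    ext z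
    rw [mem_smul_set_iff_inv_smul_mem₀ hpi.ne']
    simp only [Set.mem_prod, Q2, I2pi, Set.mem_Ioc, Prod.smul_fst, Prod.smul_snd, smul_eq_mul,
      inv_mul_le_iff₀ hpi, mul_one, mul_pos_iff_of_pos_left (inv_pos.2 hpi)]
  rw [hs] at h2
  simp only [Module.finrank_prod, Module.finrank_self] at h2
  rw [h2] at h1
  rw [← h1]
  congr 1
  congr 1
  ext x
  simp [MeasurableEquiv.finTwoArrow, Fin.forall_fin_two]

/-- Periodization to the unit torus of the restriction of `F` to the fundamental domain `Q2`. -/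
def liftUnitTorus (F : ℝ × ℝ → ℂ) (t : UnitAddTorus (Fin 2)) : ℂ :=
  F (2 * π * (AddCircle.equivIoc 1 0 (t 0) : ℝ), 2 * π * (AddCircle.equivIoc 1 0 (t 1) : ℝ))

theorem liftUnitTorus_coe (F : ℝ × ℝ → ℂ) {x : Fin 2 → ℝ}
    (hx : ∀ i, x i ∈ Ioc (0 : ℝ) (0 + 1)) :
    liftUnitTorus F (fun i => (x i : UnitAddCircle)) = F (2 * π * x 0, 2 * π * x 1) := by
  simp only [liftUnitTorus]
  rw [AddCircle.equivIoc_coe_of_mem (hx 0), AddCircle.equivIoc_coe_of_mem (hx 1)]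

theorem mFourierCoeff_liftUnitTorus (F : ℝ × ℝ → ℂ) (n : Fin 2 → ℤ) :
    UnitAddTorus.mFourierCoeff (liftUnitTorus F) n = fcC F (n 0, n 1) := by
  have hpi : (2 * π : ℂ) ≠ 0 := by simp [Real.pi_ne_zero]
  rw [UnitAddTorus.mFourierCoeff_eq_integral _ _ 0]
  have := integral_unit_square_comp_smul (fun x => F x *
    Complex.exp (-(Complex.I) * ((n 0 : ℂ) * (x.1 : ℂ) + (n 1 : ℂ) * (x.2 : ℂ))))
  simp only [fcC]
  rw [Complex.real_smul] at this
  have hc : ((((2 * π) ^ 2)⁻¹ : ℝ) : ℂ) = 1 / (2 * π) ^ 2 := by push_cast; simp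
  rw [hc] at this
  rw [← this]
  refine setIntegral_congr_fun ?_ ?_
  · exact MeasurableSet.univ_pi' (fun i => measurableSet_Ioc)
  · intro x hx
    simp only [liftUnitTorus_coe F hx, smul_eq_mul, mul_comm (F _)]
    congr 1
    simp only [UnitAddTorus.mFourier, ContinuousMap.coe_mk, Fin.prod_univ_two, Pi.neg_apply,
      fourier_coe_apply, ← Complex.exp_add]
    congr 1
    push_cast
    ring

theorem memLp_liftUnitTorus {F : ℝ × ℝ → ℂ} (hF : Continuous F) :
    MemLp (liftUnitTorus F) 2 (volume : Measure (UnitAddTorus (Fin 2))) := by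
  have hK : IsCompact (Icc (0 : ℝ) (2 * π) ×ˢ Icc (0 : ℝ) (2 * π)) :=
    isCompact_Icc.prod isCompact_Icc
  obtain ⟨C, hC⟩ := hK.exists_bound_of_continuousOn hF.continuousOn
  have hm : Measurable (fun s : UnitAddCircle => (AddCircle.equivIoc 1 0 s : ℝ)) :=
    measurable_subtype_coe.comp (AddCircle.measurableEquivIoc 1 0).measurable
  have hmem : ∀ s : UnitAddCircle,
      2 * π * (AddCircle.equivIoc 1 0 s : ℝ) ∈ Icc (0 : ℝ) (2 * π) := by
    intro s
    have h := (AddCircle.equivIoc 1 0 s).2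
    have hpi := Real.pi_pos
    constructor
    · have := h.1.le
      positivity
    · have := h.2
      nlinarith
  have hmeas : Measurable (liftUnitTorus F) := by
    refine hF.measurable.comp (Measurable.prodMk ?_ ?_)
    · exact (hm.comp (measurable_pi_apply (X := fun _ : Fin 2 => UnitAddCircle) 0)).const_mul _
    · exact (hm.comp (measurable_pi_apply (X := fun _ : Fin 2 => UnitAddCircle) 1)).const_mul _
  have := isProbabilityMeasure_volume_unitAddCircle
  exact MemLp.of_bound hmeas.aestronglyMeasurable C
    (Filter.Eventually.of_forall fun t => hC _ ⟨hmem _, hmem _⟩)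

/-- Parseval's identity on the torus `(ℝ/2πℤ)²`. -/
theorem hasSum_sq_fcC {F : ℝ × ℝ → ℂ} (hF : Continuous F) :
    HasSum (fun k => ‖fcC F k‖ ^ 2) (((2 * π) ^ 2)⁻¹ * ∫ x in Q2, ‖F x‖ ^ 2) := by
  have hL := memLp_liftUnitTorus hF
  have h := UnitAddTorus.hasSum_sq_mFourierCoeff (hL.toLp _)
  have hcoeff : ∀ n, UnitAddTorus.mFourierCoeff (hL.toLp _) n = fcC F (n 0, n 1) := by
    intro n
    rw [← mFourierCoeff_liftUnitTorus]
    refine integral_congr_ae ?_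
    filter_upwards [hL.coeFn_toLp] with t ht
    rw [ht]
  have hint : ∫ t, ‖hL.toLp _ t‖ ^ 2 = ((2 * π) ^ 2)⁻¹ * ∫ x in Q2, ‖F x‖ ^ 2 := by
    rw [← smul_eq_mul, ← integral_unit_square_comp_smul (fun x => ‖F x‖ ^ 2)]
    have h1 : ∫ t, ‖hL.toLp _ t‖ ^ 2 = ∫ t, ‖liftUnitTorus F t‖ ^ 2 := by
      refine integral_congr_ae ?_
      filter_upwards [hL.coeFn_toLp] with t ht
      rw [ht]
    rw [h1, UnitAddTorus.integral_preimage _ 0]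
    refine setIntegral_congr_fun (MeasurableSet.univ_pi' (fun i => measurableSet_Ioc)) ?_
    intro x hx
    simp only [liftUnitTorus_coe F hx]
  simp only [hcoeff, hint] at h
  rw [← (finTwoArrowEquiv ℤ).hasSum_iff]
  exact h

end Parseval

theorem Smooth.continuous {f : ℝ × ℝ → ℝ} (hf : Smooth f) : Continuous f :=
  ContDiff.continuous hf

theorem Smooth.differentiable {f : ℝ × ℝ → ℝ} (hf : Smooth f) : Differentiable ℝ f :=
  ContDiff.differentiable hf (by simp)

theorem Smooth.fderiv_apply {f : ℝ × ℝ → ℝ} (hf : Smooth f) (e : ℝ × ℝ) :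
    Smooth (fun x => fderiv ℝ f x e) := by
  have h : ContDiff ℝ (⊤ : ℕ∞) (fderiv ℝ f) := ContDiff.fderiv_right hf (by simp)
  exact h.clm_apply contDiff_const

theorem Smooth.pd1 {f : ℝ × ℝ → ℝ} (hf : Smooth f) : Smooth (pd1 f) := hf.fderiv_apply _

theorem Smooth.pd2 {f : ℝ × ℝ → ℝ} (hf : Smooth f) : Smooth (pd2 f) := hf.fderiv_apply _

theorem Per.fderiv_apply {f : ℝ × ℝ → ℝ} (hf : Per f) (e : ℝ × ℝ) :
    Per (fun x => fderiv ℝ f x e) := by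
  have key : ∀ a : ℝ × ℝ, (∀ x, f (x + a) = f x) → ∀ x, fderiv ℝ f (x + a) = fderiv ℝ f x := by
    intro a ha x
    rw [← fderiv_comp_add_right]
    simp only [ha]
  refine ⟨fun x => ?_, fun x => ?_⟩
  · have h := key (2 * π, 0) (fun x => by simpa [Prod.add_def] using hf.1 x) x
    simp only [Prod.add_def, add_zero] at h
    simp only [h]
  · have h := key (0, 2 * π) (fun x => by simpa [Prod.add_def] using hf.2 x) x
    simp only [Prod.add_def, add_zero] at h
    simp only [h]

theorem Per.pd1 {f : ℝ × ℝ → ℝ} (hf : Per f) : Per (pd1 f) := hf.fderiv_apply _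

theorem Per.pd2 {f : ℝ × ℝ → ℝ} (hf : Per f) : Per (pd2 f) := hf.fderiv_apply _

theorem integrableOn_I2pi {E : Type*} [NormedAddCommGroup E] {f : ℝ → E}
    (hf : Continuous f) : IntegrableOn f I2pi :=
  (hf.continuousOn.integrableOn_compact isCompact_Icc).mono_set Ioc_subset_Icc_self

theorem integrableOn_Q2 {E : Type*} [NormedAddCommGroup E] {f : ℝ × ℝ → E}
    (hf : Continuous f) : IntegrableOn f Q2 :=
  (hf.continuousOn.integrableOn_compact (isCompact_Icc.prod isCompact_Icc)).mono_set
    (Set.prod_mono Ioc_subset_Icc_self Ioc_subset_Icc_self)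

theorem volume_restrict_Q2 :
    (volume : Measure (ℝ × ℝ)).restrict Q2 = (volume.restrict I2pi).prod (volume.restrict I2pi) := by
  rw [Measure.prod_restrict]
  rfl

theorem hasDerivAt_fst {E : Type*} [NormedAddCommGroup E] [NormedSpace ℝ E] {h : ℝ × ℝ → E}
    (hh : Differentiable ℝ h) (s t : ℝ) :
    HasDerivAt (fun s => h (s, t)) (fderiv ℝ h (s, t) (1, 0)) s :=
  (hh (s, t)).hasFDerivAt.comp_hasDerivAt s ((hasDerivAt_id s).prodMk (hasDerivAt_const s t))

theorem hasDerivAt_snd {E : Type*} [NormedAddCommGroup E] [NormedSpace ℝ E] {h : ℝ × ℝ → E}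
    (hh : Differentiable ℝ h) (s t : ℝ) :
    HasDerivAt (fun t => h (s, t)) (fderiv ℝ h (s, t) (0, 1)) t :=
  (hh (s, t)).hasFDerivAt.comp_hasDerivAt t ((hasDerivAt_const t s).prodMk (hasDerivAt_id t))

theorem integral_I2pi_deriv_eq_zero {g g' : ℝ → ℂ} (hg : ∀ s, HasDerivAt g (g' s) s)
    (hc : Continuous g') (hper : g (2 * π) = g 0) : ∫ s in I2pi, g' s = 0 := by
  rw [I2pi, ← intervalIntegral.integral_of_le (by positivity),
    intervalIntegral.integral_eq_sub_of_hasDerivAt (fun x _ => hg x) (hc.intervalIntegrable _ _),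
    hper, sub_self]

theorem integral_fderiv_fst_eq_zero {h : ℝ × ℝ → ℂ} (hh : ContDiff ℝ 1 h)
    (hper : ∀ x : ℝ × ℝ, h (x.1 + 2 * π, x.2) = h x) :
    ∫ x in Q2, fderiv ℝ h x (1, 0) = 0 := by
  have hc : Continuous (fun x => fderiv ℝ h x (1, 0)) :=
    (hh.continuous_fderiv (by simp)).clm_apply continuous_const
  have hi := integrableOn_Q2 hc
  rw [IntegrableOn, volume_restrict_Q2] at hi
  rw [volume_restrict_Q2, integral_prod_symm _ hi]
  have : ∀ t, ∫ s in I2pi, fderiv ℝ h (s, t) (1, 0) = 0 := fun t =>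
    integral_I2pi_deriv_eq_zero (hasDerivAt_fst (hh.differentiable (by simp)) · t)
      (hc.comp (by fun_prop)) (by simpa using hper (0, t))
  simp [this]

theorem integral_fderiv_snd_eq_zero {h : ℝ × ℝ → ℂ} (hh : ContDiff ℝ 1 h)
    (hper : ∀ x : ℝ × ℝ, h (x.1, x.2 + 2 * π) = h x) :
    ∫ x in Q2, fderiv ℝ h x (0, 1) = 0 := by
  have hc : Continuous (fun x => fderiv ℝ h x (0, 1)) :=
    (hh.continuous_fderiv (by simp)).clm_apply continuous_const
  have hi := integrableOn_Q2 hc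
  rw [IntegrableOn, volume_restrict_Q2] at hi
  rw [volume_restrict_Q2, integral_prod _ hi]
  have : ∀ s, ∫ t in I2pi, fderiv ℝ h (s, t) (0, 1) = 0 := fun s =>
    integral_I2pi_deriv_eq_zero (hasDerivAt_snd (hh.differentiable (by simp)) s)
      (hc.comp (by fun_prop)) (by simpa using hper (s, 0))
  simp [this]

/-- The character `e^{-ik·x}` in the definition of the Fourier coefficients. -/
def character (k : ℤ × ℤ) (x : ℝ × ℝ) : ℂ :=
  Complex.exp (-(Complex.I) * ((k.1 : ℂ) * (x.1 : ℂ) + (k.2 : ℂ) * (x.2 : ℂ)))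

theorem contDiff_character (k : ℤ × ℤ) : ContDiff ℝ 1 (character k) := by
  have h1 : ContDiff ℝ 1 (fun x : ℝ × ℝ => (x.1 : ℂ)) := Complex.ofRealCLM.contDiff.comp contDiff_fst
  have h2 : ContDiff ℝ 1 (fun x : ℝ × ℝ => (x.2 : ℂ)) := Complex.ofRealCLM.contDiff.comp contDiff_snd
  exact (contDiff_const.mul ((contDiff_const.mul h1).add (contDiff_const.mul h2))).cexp

theorem character_periodic_fst (k : ℤ × ℤ) (x : ℝ × ℝ) :
    character k (x.1 + 2 * π, x.2) = character k x := by
  simp only [character]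
  rw [Complex.exp_eq_exp_iff_exists_int]
  exact ⟨-k.1, by push_cast; ring⟩

theorem character_periodic_snd (k : ℤ × ℤ) (x : ℝ × ℝ) :
    character k (x.1, x.2 + 2 * π) = character k x := by
  simp only [character]
  rw [Complex.exp_eq_exp_iff_exists_int]
  exact ⟨-k.2, by push_cast; ring⟩

theorem fderiv_character (k : ℤ × ℤ) (x e : ℝ × ℝ) :
    fderiv ℝ (character k) x e =
      character k x * (-(Complex.I) * ((k.1 : ℂ) * (e.1 : ℂ) + (k.2 : ℂ) * (e.2 : ℂ))) := by
  have h1 : HasFDerivAt (fun x : ℝ × ℝ => (x.1 : ℂ))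
      (Complex.ofRealCLM.comp (ContinuousLinearMap.fst ℝ ℝ ℝ)) x :=
    (Complex.ofRealCLM.comp (ContinuousLinearMap.fst ℝ ℝ ℝ)).hasFDerivAt
  have h2 : HasFDerivAt (fun x : ℝ × ℝ => (x.2 : ℂ))
      (Complex.ofRealCLM.comp (ContinuousLinearMap.snd ℝ ℝ ℝ)) x :=
    (Complex.ofRealCLM.comp (ContinuousLinearMap.snd ℝ ℝ ℝ)).hasFDerivAt
  have h := (((h1.const_mul (k.1 : ℂ)).add (h2.const_mul (k.2 : ℂ))).const_mul
    (-(Complex.I))).cexp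
  have h' : HasFDerivAt (character k) _ x := h
  rw [h'.fderiv]
  simp [character]
  ring

theorem fderiv_mul_character {f : ℝ × ℝ → ℝ} (hf : Smooth f) (k : ℤ × ℤ) (x e : ℝ × ℝ) :
    fderiv ℝ (fun x => (f x : ℂ) * character k x) x e =
      (fderiv ℝ f x e : ℂ) * character k x +
        (-(Complex.I) * ((k.1 : ℂ) * (e.1 : ℂ) + (k.2 : ℂ) * (e.2 : ℂ))) *
          ((f x : ℂ) * character k x) := by
  have h1 : HasFDerivAt (fun x => (f x : ℂ)) (Complex.ofRealCLM.comp (fderiv ℝ f x)) x :=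
    Complex.ofRealCLM.hasFDerivAt.comp x (hf.differentiable x).hasFDerivAt
  have h2 := ((contDiff_character k).differentiable (by simp) x).hasFDerivAt
  have h3 : HasFDerivAt (fun x => (f x : ℂ) * character k x) _ x := h1.mul h2
  rw [h3.fderiv]
  simp [fderiv_character]
  ring

theorem contDiff_mul_character {f : ℝ × ℝ → ℝ} (hf : Smooth f) (k : ℤ × ℤ) :
    ContDiff ℝ 1 (fun x => (f x : ℂ) * character k x) :=
  (Complex.ofRealCLM.contDiff.comp (ContDiff.of_le hf (by simp))).mul (contDiff_character k)

theorem fc_fderiv_apply {f : ℝ × ℝ → ℝ} (hf : Smooth f) (k : ℤ × ℤ) (e : ℝ × ℝ)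
    (h0 : ∫ x in Q2, fderiv ℝ (fun x => (f x : ℂ) * character k x) x e = 0) :
    fc (fun x => fderiv ℝ f x e) k =
      Complex.I * ((k.1 : ℂ) * (e.1 : ℂ) + (k.2 : ℂ) * (e.2 : ℂ)) * fc f k := by
  have hch := (contDiff_character k).continuous
  have hi1 : IntegrableOn (fun x => (fderiv ℝ f x e : ℂ) * character k x) Q2 :=
    integrableOn_Q2 ((Complex.continuous_ofReal.comp (hf.fderiv_apply e).continuous).mul hch)
  have hi2 : IntegrableOn (fun x => (f x : ℂ) * character k x) Q2 :=
    integrableOn_Q2 ((Complex.continuous_ofReal.comp hf.continuous).mul hch)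
  simp only [fderiv_mul_character hf] at h0
  rw [integral_add hi1 (hi2.const_mul _), integral_const_mul] at h0
  simp only [fc, fcC]
  simp only [character] at h0
  linear_combination (1 / (2 * π) ^ 2 : ℂ) * h0

theorem fc_pd1 {f : ℝ × ℝ → ℝ} (hf : Smooth f) (hp : Per f) (k : ℤ × ℤ) :
    fc (pd1 f) k = Complex.I * k.1 * fc f k := by
  have h := fc_fderiv_apply hf k (1, 0) (integral_fderiv_fst_eq_zero (contDiff_mul_character hf k)
    fun x => by rw [hp.1, character_periodic_fst])
  simp only [Complex.ofReal_one, Complex.ofReal_zero, mul_one, mul_zero, add_zero] at h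
  exact h

theorem fc_pd2 {f : ℝ × ℝ → ℝ} (hf : Smooth f) (hp : Per f) (k : ℤ × ℤ) :
    fc (pd2 f) k = Complex.I * k.2 * fc f k := by
  have h := fc_fderiv_apply hf k (0, 1) (integral_fderiv_snd_eq_zero (contDiff_mul_character hf k)
    fun x => by rw [hp.2, character_periodic_snd])
  simp only [Complex.ofReal_one, Complex.ofReal_zero, mul_one, mul_zero, zero_add] at h
  exact h

theorem hasSum_sq_fc {f : ℝ × ℝ → ℝ} (hf : Continuous f) :
    HasSum (fun k => ‖fc f k‖ ^ 2) (((2 * π) ^ 2)⁻¹ * ∫ x in Q2, f x ^ 2) := by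
  simpa [fc, Function.comp_def] using hasSum_sq_fcC (Complex.continuous_ofReal.comp hf)

theorem HSq_one_zero {f : ℝ × ℝ → ℝ} (hf : Smooth f) (hp : Per f) :
    (2 * π) ^ 2 * HSq 1 0 f = (∫ x in Q2, f x ^ 2) + ∫ x in Q2, pd1 f x ^ 2 := by
  have h := (hasSum_sq_fc hf.continuous).add (hasSum_sq_fc hf.pd1.continuous)
  have hpi : (2 * π) ^ 2 ≠ 0 := by positivity
  have hk : (fun k => aw 1 0 k * ‖fc f k‖ ^ 2) = fun k => ‖fc f k‖ ^ 2 + ‖fc (pd1 f) k‖ ^ 2 := by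
    ext k
    simp only [aw, fc_pd1 hf hp, Real.rpow_one, Real.rpow_zero, norm_mul, Complex.norm_I,
      Complex.norm_intCast, mul_pow, sq_abs]
    ring
  rw [HSq, hk, h.tsum_eq]
  field_simp

/-- The weighted sum defining `HSq 1 1 f`, written through Parseval's identity for `f` and its
derivatives; `g` is either of the mixed second derivatives of `f`. -/
theorem HSq_one_one_of_fc_eq {f g : ℝ × ℝ → ℝ} (hf : Smooth f) (hp : Per f) (hg : Continuous g)
    (hgk : ∀ k : ℤ × ℤ, ‖fc g k‖ ^ 2 = (k.1 : ℝ) ^ 2 * (k.2 : ℝ) ^ 2 * ‖fc f k‖ ^ 2) :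
    (2 * π) ^ 2 * HSq 1 1 f = (∫ x in Q2, f x ^ 2) + (∫ x in Q2, pd1 f x ^ 2) +
      (∫ x in Q2, pd2 f x ^ 2) + ∫ x in Q2, g x ^ 2 := by
  have h := (((hasSum_sq_fc hf.continuous).add (hasSum_sq_fc hf.pd1.continuous)).add
    (hasSum_sq_fc hf.pd2.continuous)).add (hasSum_sq_fc hg)
  have hpi : (2 * π) ^ 2 ≠ 0 := by positivity
  have hk : (fun k => aw 1 1 k * ‖fc f k‖ ^ 2) = fun k =>
      ‖fc f k‖ ^ 2 + ‖fc (pd1 f) k‖ ^ 2 + ‖fc (pd2 f) k‖ ^ 2 + ‖fc g k‖ ^ 2 := by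
    ext k
    simp only [aw, fc_pd1 hf hp, fc_pd2 hf hp, hgk, Real.rpow_one, norm_mul, Complex.norm_I,
      Complex.norm_intCast, mul_pow, sq_abs]
    ring
  rw [HSq, hk, h.tsum_eq]
  field_simp

theorem integral_sq_nonneg (f : ℝ × ℝ → ℝ) : 0 ≤ ∫ x in Q2, f x ^ 2 :=
  integral_nonneg fun _ => sq_nonneg _

theorem integral_sq_pd1_le {f : ℝ × ℝ → ℝ} (hf : Smooth f) (hp : Per f) :
    (∫ x in Q2, pd1 f x ^ 2) + ∫ x in Q2, pd2 (pd1 f) x ^ 2 ≤ (2 * π) ^ 2 * HSq 1 1 f := by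
  rw [HSq_one_one_of_fc_eq hf hp hf.pd1.pd2.continuous fun k => by
    simp only [fc_pd2 hf.pd1 hp.pd1, fc_pd1 hf hp, norm_mul, Complex.norm_I,
      Complex.norm_intCast, mul_pow, sq_abs]
    ring]
  linarith [integral_sq_nonneg f, integral_sq_nonneg (pd2 f)]

theorem integral_sq_pd2_le {f : ℝ × ℝ → ℝ} (hf : Smooth f) (hp : Per f) :
    (∫ x in Q2, pd2 f x ^ 2) + ∫ x in Q2, pd1 (pd2 f) x ^ 2 ≤ (2 * π) ^ 2 * HSq 1 1 f := by
  rw [HSq_one_one_of_fc_eq hf hp hf.pd2.pd1.continuous fun k => by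
    simp only [fc_pd1 hf.pd2 hp.pd2, fc_pd2 hf hp, norm_mul, Complex.norm_I,
      Complex.norm_intCast, mul_pow, sq_abs]
    ring]
  linarith [integral_sq_nonneg f, integral_sq_nonneg (pd1 f)]

theorem HSq_nonneg (s s' : ℝ) (f : ℝ × ℝ → ℝ) : 0 ≤ HSq s s' f :=
  tsum_nonneg fun k => mul_nonneg
    (mul_nonneg (Real.rpow_nonneg (by positivity) _) (Real.rpow_nonneg (by positivity) _))
    (sq_nonneg _)

/-- One-dimensional Sobolev bound on an interval of length `2π`. -/
theorem sq_le_two_mul_integral {g g' : ℝ → ℝ} (hg : ∀ s, HasDerivAt g (g' s) s)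
    (hc : Continuous g') {x : ℝ} (hx : x ∈ I2pi) :
    g x ^ 2 ≤ 2 * ∫ y in I2pi, (g y ^ 2 + g' y ^ 2) := by
  have hgc : Continuous g := continuous_iff_continuousAt.2 fun s => (hg s).continuousAt
  set M := ∫ y in I2pi, (g y ^ 2 + g' y ^ 2) with hM
  have hiM : IntegrableOn (fun y => g y ^ 2 + g' y ^ 2) I2pi := integrableOn_I2pi (by fun_prop)
  have hM0 : 0 ≤ M := integral_nonneg fun y => by positivity
  have key : ∀ y ∈ I2pi, g x ^ 2 ≤ g y ^ 2 + M := by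
    intro y hy
    have hd : ∀ s, HasDerivAt (fun s => g s ^ 2) (2 * g s * g' s) s := fun s => by
      simpa using! (hg s).pow 2
    have hc2 : Continuous (fun s => 2 * g s * g' s) := by fun_prop
    have h1 := intervalIntegral.integral_eq_sub_of_hasDerivAt (a := y) (b := x)
      (fun s _ => hd s) (hc2.intervalIntegrable _ _)
    have h2 : |∫ s in y..x, 2 * g s * g' s| ≤ M := by
      refine (Real.norm_eq_abs _).symm.trans_le
        (intervalIntegral.norm_integral_le_integral_norm_uIoc.trans ?_)
      have hsub : uIoc y x ⊆ I2pi := by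
        intro s hs
        rw [mem_uIoc] at hs
        simp only [I2pi, Set.mem_Ioc] at *
        rcases hs with hs | hs <;> constructor <;> linarith [hs.1, hs.2]
      have h3 : ∫ s in uIoc y x, ‖2 * g s * g' s‖ ≤ ∫ s in uIoc y x, (g s ^ 2 + g' s ^ 2) := by
        refine integral_mono ((integrableOn_I2pi hc2).mono_set hsub).norm (hiM.mono_set hsub) ?_
        intro s
        simp only [Real.norm_eq_abs]
        rw [abs_le]
        constructor <;> nlinarith [sq_nonneg (g s + g' s), sq_nonneg (g s - g' s)]
      refine h3.trans (setIntegral_mono_set hiM ?_ hsub.eventuallyLE)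
      exact Filter.Eventually.of_forall fun s => by positivity
    linarith [le_abs_self (∫ s in y..x, 2 * g s * g' s)]
  have hvol : volume.real I2pi = 2 * π := by
    simp [I2pi, Measure.real, ENNReal.toReal_ofReal, Real.pi_pos.le]
  have hfin : IsFiniteMeasure (volume.restrict I2pi) := by
    rw [I2pi]
    infer_instance
  have hg2 : IntegrableOn (fun y => g y ^ 2) I2pi := integrableOn_I2pi (by fun_prop)
  have h4 : ∫ _ in I2pi, g x ^ 2 ≤ ∫ y in I2pi, (g y ^ 2 + M) :=
    setIntegral_mono_on (integrable_const _) (hg2.add (integrable_const _))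
      measurableSet_Ioc key
  rw [integral_add hg2 (integrable_const _)] at h4
  simp only [setIntegral_const, hvol, smul_eq_mul] at h4
  have h5 : ∫ y in I2pi, g y ^ 2 ≤ M :=
    integral_mono hg2 hiM fun y => le_add_of_nonneg_right (sq_nonneg _)
  have hpi := Real.pi_gt_three
  nlinarith

/-- Anisotropic product estimate: `‖fg‖_{L²}` is controlled by one vertical derivative of `f` and
one horizontal derivative of `g`. -/
theorem integral_sq_mul_sq_le {f g : ℝ × ℝ → ℝ} (hf : Smooth f) (hg : Smooth g) :
    ∫ x in Q2, (f x * g x) ^ 2 ≤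
      4 * ((∫ x in Q2, f x ^ 2) + ∫ x in Q2, pd2 f x ^ 2) *
        ((∫ x in Q2, g x ^ 2) + ∫ x in Q2, pd1 g x ^ 2) := by
  have hfc := hf.continuous
  have hf2 := hf.pd2.continuous
  have hgc := hg.continuous
  have hg1 := hg.pd1.continuous
  set F : ℝ × ℝ → ℝ := fun x => f x ^ 2 + pd2 f x ^ 2
  set G : ℝ × ℝ → ℝ := fun x => g x ^ 2 + pd1 g x ^ 2
  have hiF : IntegrableOn F Q2 := integrableOn_Q2 (by fun_prop)
  have hiG : IntegrableOn G Q2 := integrableOn_Q2 (by fun_prop)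
  have hFeq : (∫ x in Q2, f x ^ 2) + ∫ x in Q2, pd2 f x ^ 2 = ∫ x in Q2, F x :=
    (integral_add (integrableOn_Q2 (by fun_prop)) (integrableOn_Q2 (by fun_prop))).symm
  have hGeq : (∫ x in Q2, g x ^ 2) + ∫ x in Q2, pd1 g x ^ 2 = ∫ x in Q2, G x :=
    (integral_add (integrableOn_Q2 (by fun_prop)) (integrableOn_Q2 (by fun_prop))).symm
  rw [hFeq, hGeq]
  have hiL : IntegrableOn (fun x => (f x * g x) ^ 2) Q2 := integrableOn_Q2 (by fun_prop)
  rw [IntegrableOn, volume_restrict_Q2] at hiF hiG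
  have hA := hiF.integral_prod_left
  have hB := hiG.integral_prod_right
  have hAB := (hA.mul_prod hB).const_mul 4
  rw [← volume_restrict_Q2] at hAB
  have hle : ∫ x in Q2, (f x * g x) ^ 2 ≤
      ∫ x in Q2, 4 * ((∫ t in I2pi, F (x.1, t)) * ∫ s in I2pi, G (s, x.2)) := by
    refine setIntegral_mono_on hiL hAB (measurableSet_Ioc.prod measurableSet_Ioc) ?_
    rintro ⟨s, t⟩ ⟨hs, ht⟩
    have h1 := sq_le_two_mul_integral (hasDerivAt_snd hf.differentiable s)
      (hf2.comp (by fun_prop : Continuous fun t : ℝ => (s, t))) ht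
    have h2 := sq_le_two_mul_integral (hasDerivAt_fst hg.differentiable · t)
      (hg1.comp (by fun_prop : Continuous fun s : ℝ => (s, t))) hs
    rw [mul_pow]
    calc f (s, t) ^ 2 * g (s, t) ^ 2
        ≤ (2 * ∫ t in I2pi, F (s, t)) * (2 * ∫ s in I2pi, G (s, t)) :=
          mul_le_mul h1 h2 (sq_nonneg _) ((sq_nonneg _).trans h1)
      _ = _ := by ring
  refine hle.trans_eq ?_
  rw [integral_const_mul, volume_restrict_Q2,
    integral_prod_mul (fun s => ∫ t in I2pi, F (s, t)) (fun t => ∫ s in I2pi, G (s, t)),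
    ← integral_prod _ hiF, ← integral_prod_symm _ hiG, mul_assoc]

theorem sq_integral_mul_le {F w : ℝ × ℝ → ℝ} (hF : Continuous F) (hw : Continuous w) :
    (∫ x in Q2, F x * w x) ^ 2 ≤ (∫ x in Q2, F x ^ 2) * ∫ x in Q2, w x ^ 2 := by
  have hFF : IntegrableOn (fun x => F x ^ 2) Q2 := integrableOn_Q2 (by fun_prop)
  have hww : IntegrableOn (fun x => w x ^ 2) Q2 := integrableOn_Q2 (by fun_prop)
  have hFw : IntegrableOn (fun x => F x * w x) Q2 := integrableOn_Q2 (by fun_prop)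
  have h : ∀ t : ℝ, 0 ≤ (∫ x in Q2, w x ^ 2) * (t * t) + (2 * ∫ x in Q2, F x * w x) * t +
      ∫ x in Q2, F x ^ 2 := by
    intro t
    have h0 : 0 ≤ ∫ x in Q2, (F x + t * w x) ^ 2 := integral_nonneg fun x => sq_nonneg _
    have h1 : ∀ x, (F x + t * w x) ^ 2 = F x ^ 2 + ((2 * t) * (F x * w x) + t ^ 2 * w x ^ 2) :=
      fun x => by ring
    simp only [h1] at h0
    have hsum : IntegrableOn (fun x => (2 * t) * (F x * w x) + t ^ 2 * w x ^ 2) Q2 :=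
      (hFw.const_mul _).add (hww.const_mul _)
    rw [integral_add hFF hsum,
      integral_add (hFw.const_mul _) (hww.const_mul _), integral_const_mul,
      integral_const_mul] at h0
    linarith
  have := discrim_le_zero h
  rw [discrim] at this
  nlinarith

theorem integrableOn_Q2_mul_mul {f g w : ℝ × ℝ → ℝ} (hf : Continuous f) (hg : Continuous g)
    (hw : Continuous w) : IntegrableOn (fun x => f x * g x * w x) Q2 :=
  integrableOn_Q2 ((hf.mul hg).mul hw)

theorem abs_integral_mul_mul_le {f g w : ℝ × ℝ → ℝ} (hf : Smooth f) (hg : Smooth g)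
    (hw : Continuous w) {A B W : ℝ} (hA : 0 ≤ A) (hB : 0 ≤ B) (hW : 0 ≤ W)
    (hfA : (∫ x in Q2, f x ^ 2) + ∫ x in Q2, pd2 f x ^ 2 ≤ (2 * π) ^ 2 * A ^ 2)
    (hgB : (∫ x in Q2, g x ^ 2) + ∫ x in Q2, pd1 g x ^ 2 ≤ (2 * π) ^ 2 * B ^ 2)
    (hwW : ∫ x in Q2, w x ^ 2 ≤ W ^ 2) :
    |∫ x in Q2, f x * g x * w x| ≤ 8 * π ^ 2 * (A * B * W) := by
  refine abs_le_of_sq_le_sq ?_ (by positivity)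
  calc (∫ x in Q2, f x * g x * w x) ^ 2
      ≤ (∫ x in Q2, (f x * g x) ^ 2) * ∫ x in Q2, w x ^ 2 :=
        sq_integral_mul_le (hf.continuous.mul hg.continuous) hw
    _ ≤ (4 * ((2 * π) ^ 2 * A ^ 2) * ((2 * π) ^ 2 * B ^ 2)) * W ^ 2 := by
        refine mul_le_mul ((integral_sq_mul_sq_le hf hg).trans ?_) hwW (integral_sq_nonneg w)
          (by positivity)
        have := integral_sq_nonneg g
        have := integral_sq_nonneg (pd1 g)
        gcongr
    _ = (8 * π ^ 2 * (A * B * W)) ^ 2 := by ring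

/-- There is a constant `C > 0` such that for all smooth divergence-free
vector fields `u, v, w : 𝕋² → ℝ²`, one has `|b(u,v,w)| ≤ C ‖u‖_{H^{1,0}} ‖v‖_{H^{1,1}} ‖w‖_{L²}`. -/
theorem b_trilinear_estimate :
    ∃ C > 0, ∀ u v w : ℝ × ℝ → ℝ × ℝ,
      SmoothV u → PerV u → DivFree u →
      SmoothV v → PerV v → DivFree v →
      SmoothV w → PerV w → DivFree w →
      |b3 u v w| ≤ C * HNV 1 0 u * HNV 1 1 v * L2V w := by
  refine ⟨32 * π ^ 2, by positivity, ?_⟩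
  intro u v w hu hpu hdu hv hpv _ hw _ _
  have hu1 : Smooth (comp1 u) := hu.fst
  have hu2 : Smooth (comp2 u) := hu.snd
  have hv1 : Smooth (comp1 v) := hv.fst
  have hv2 : Smooth (comp2 v) := hv.snd
  have hw1 : Continuous (comp1 w) := hw.fst.continuous
  have hw2 : Continuous (comp2 w) := hw.snd.continuous
  have hA : HNV 1 0 u ^ 2 = HSq 1 0 (comp1 u) + HSq 1 0 (comp2 u) :=
    Real.sq_sqrt (add_nonneg (HSq_nonneg _ _ _) (HSq_nonneg _ _ _))
  have hB : HNV 1 1 v ^ 2 = HSq 1 1 (comp1 v) + HSq 1 1 (comp2 v) :=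
    Real.sq_sqrt (add_nonneg (HSq_nonneg _ _ _) (HSq_nonneg _ _ _))
  have hA0 : 0 ≤ HNV 1 0 u := Real.sqrt_nonneg _
  have hB0 : 0 ≤ HNV 1 1 v := Real.sqrt_nonneg _
  have hW0 : 0 ≤ L2V w := Real.sqrt_nonneg _
  have hW : L2V w ^ 2 = (∫ x in Q2, comp1 w x ^ 2) + ∫ x in Q2, comp2 w x ^ 2 := by
    rw [← integral_add (integrableOn_Q2 (by fun_prop)) (integrableOn_Q2 (by fun_prop))]
    exact Real.sq_sqrt (integral_nonneg fun _ => by positivity)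
  have hpi : 0 ≤ (2 * π) ^ 2 := by positivity
  have hw1W : ∫ x in Q2, comp1 w x ^ 2 ≤ L2V w ^ 2 := by
    linarith [integral_sq_nonneg (comp2 w)]
  have hw2W : ∫ x in Q2, comp2 w x ^ 2 ≤ L2V w ^ 2 := by
    linarith [integral_sq_nonneg (comp1 w)]
  have hu1A : (∫ x in Q2, comp1 u x ^ 2) + ∫ x in Q2, pd1 (comp1 u) x ^ 2 ≤
      (2 * π) ^ 2 * HNV 1 0 u ^ 2 := by
    rw [← HSq_one_zero hu1 hpu.1, hA]
    exact mul_le_mul_of_nonneg_left (le_add_of_nonneg_right (HSq_nonneg _ _ _)) hpi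
  have hu2A : (∫ x in Q2, comp2 u x ^ 2) + ∫ x in Q2, pd2 (comp2 u) x ^ 2 ≤
      (2 * π) ^ 2 * HNV 1 0 u ^ 2 := by
    have hdiv : ∀ x, pd2 (comp2 u) x ^ 2 = pd1 (comp1 u) x ^ 2 := fun x => by
      rw [eq_neg_of_add_eq_zero_right (hdu x), neg_sq]
    have h1 := HSq_one_zero hu1 hpu.1
    have h2 := HSq_one_zero hu2 hpu.2
    simp only [hdiv]
    rw [hA, mul_add, h1, h2]
    linarith [integral_sq_nonneg (comp1 u), integral_sq_nonneg (pd1 (comp2 u))]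
  have hv1B : (2 * π) ^ 2 * HSq 1 1 (comp1 v) ≤ (2 * π) ^ 2 * HNV 1 1 v ^ 2 := by
    rw [hB]
    exact mul_le_mul_of_nonneg_left (le_add_of_nonneg_right (HSq_nonneg _ _ _)) hpi
  have hv2B : (2 * π) ^ 2 * HSq 1 1 (comp2 v) ≤ (2 * π) ^ 2 * HNV 1 1 v ^ 2 := by
    rw [hB]
    exact mul_le_mul_of_nonneg_left (le_add_of_nonneg_left (HSq_nonneg _ _ _)) hpi
  have t11 := abs_integral_mul_mul_le hv1.pd1 hu1 hw1 hB0 hA0 hW0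
    ((integral_sq_pd1_le hv1 hpv.1).trans hv1B) hu1A hw1W
  have t12 := abs_integral_mul_mul_le hv2.pd1 hu1 hw2 hB0 hA0 hW0
    ((integral_sq_pd1_le hv2 hpv.2).trans hv2B) hu1A hw2W
  have t21 := abs_integral_mul_mul_le hu2 hv1.pd2 hw1 hA0 hB0 hW0 hu2A
    ((integral_sq_pd2_le hv1 hpv.1).trans hv1B) hw1W
  have t22 := abs_integral_mul_mul_le hu2 hv2.pd2 hw2 hA0 hB0 hW0 hu2A
    ((integral_sq_pd2_le hv2 hpv.2).trans hv2B) hw2W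
  have hsplit : b3 u v w =
      ((∫ x in Q2, pd1 (comp1 v) x * comp1 u x * comp1 w x) +
        ∫ x in Q2, comp2 u x * pd2 (comp1 v) x * comp1 w x) +
      ((∫ x in Q2, pd1 (comp2 v) x * comp1 u x * comp2 w x) +
        ∫ x in Q2, comp2 u x * pd2 (comp2 v) x * comp2 w x) := by
    have i11 := integrableOn_Q2_mul_mul hv1.pd1.continuous hu1.continuous hw1
    have i12 := integrableOn_Q2_mul_mul hv2.pd1.continuous hu1.continuous hw2
    have i21 := integrableOn_Q2_mul_mul hu2.continuous hv1.pd2.continuous hw1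
    have i22 := integrableOn_Q2_mul_mul hu2.continuous hv2.pd2.continuous hw2
    rw [← integral_add i11 i21, ← integral_add i12 i22]
    refine Eq.trans ?_ (integral_add (i11.add i21) (i12.add i22))
    refine integral_congr_ae (Filter.Eventually.of_forall fun x => ?_)
    simp only [advect, comp1, comp2]
    ring
  rw [hsplit]
  rw [abs_le] at t11 t12 t21 t22 ⊢
  constructor <;> linarith [t11.1, t11.2, t12.1, t12.2, t21.1, t21.2, t22.1, t22.2]

end Aniso
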